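/- arXiv:2604.15441 — 4 statements merged into one kernel-verified Lean document; each statement's English description precedes it below -/
import Mathlib

section
/- (Closed form of the left environment tensor.) Fix k ∈ ℝ and let R(θ) = !![cos θ, sin θ; −sin θ, cos θ] ∈ Matrix (Fin 2) (Fin 2) ℝ. Suppose T : ℕ → Matrix (Fin 2) (Fin 2) ℝ satisfies T 1 = (1/2) • !![3 + cos k, sin k; sin k, 1 − cos k] and, for all r ≥ 1, T (r+1) = (R(k/2^{r+1}))ᵀ · T r · R(k/2^{r+1}) + T r. Then for all r ≥ 1, T r = (1/2) • !![2^r + S_c(r), S_s(r); S_s(r), 2^r − S_c(r)], where S_c(r) = ∑_{m=0}^{2^r − 1} cos(k·m/2^{r−1}) and S_s(r) = ∑_{m=0}^{2^r − 1} sin(k·m/2^{r−1}). -/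
open Real Matrix

/-- The `2 × 2` rotation matrix `R(θ)`. -/
noncomputable def rotMat (θ : ℝ) : Matrix (Fin 2) (Fin 2) ℝ :=
  !![Real.cos θ, Real.sin θ; -Real.sin θ, Real.cos θ]

theorem sum_range_two_mul_aux (f : ℕ → ℝ) (n : ℕ) :
    ∑ m ∈ Finset.range (2 * n), f m
      = ∑ m ∈ Finset.range n, f (2 * m + 1) + ∑ m ∈ Finset.range n, f (2 * m) := by
  induction n with
  | zero => simp
  | succ n ih =>
    rw [show 2 * (n + 1) = 2 * n + 1 + 1 by ring, Finset.sum_range_succ, Finset.sum_range_succ, ih,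
      Finset.sum_range_succ, Finset.sum_range_succ]
    ring

/-- **Closed form of the left environment tensor.**  If `T 1` is the stated base case and
`T (r+1) = R(k/2^{r+1})ᵀ · T r · R(k/2^{r+1}) + T r` for all `r ≥ 1`, then for all `r ≥ 1`,
`T r = (1/2) • !![2^r + S_c(r), S_s(r); S_s(r), 2^r − S_c(r)]` where
`S_c(r) = ∑_{m<2^r} cos(k·m/2^{r−1})` and `S_s(r) = ∑_{m<2^r} sin(k·m/2^{r−1})`. -/
theorem left_environment_closed_form (k : ℝ) (T : ℕ → Matrix (Fin 2) (Fin 2) ℝ)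
    (hbase : T 1 = (1 / 2 : ℝ) •
      !![3 + Real.cos k, Real.sin k; Real.sin k, 1 - Real.cos k])
    (hrec : ∀ r, 1 ≤ r →
      T (r + 1) = (rotMat (k / 2 ^ (r + 1)))ᵀ * T r * rotMat (k / 2 ^ (r + 1)) + T r) :
    ∀ r, 1 ≤ r → T r = (1 / 2 : ℝ) •
      !![(2 : ℝ) ^ r + ∑ m ∈ Finset.range (2 ^ r), Real.cos (k * m / 2 ^ (r - 1)),
          ∑ m ∈ Finset.range (2 ^ r), Real.sin (k * m / 2 ^ (r - 1));
          ∑ m ∈ Finset.range (2 ^ r), Real.sin (k * m / 2 ^ (r - 1)),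
          (2 : ℝ) ^ r - ∑ m ∈ Finset.range (2 ^ r), Real.cos (k * m / 2 ^ (r - 1))] := by
  intro r hr
  induction r, hr using Nat.le_induction with
  | base =>
    rw [hbase]
    ext i j
    fin_cases i <;> fin_cases j <;> simp [Finset.sum_range_succ] <;> ring
  | succ r hr ih =>
    rw [hrec r hr, ih]
    obtain ⟨q, rfl⟩ : ∃ q, r = q + 1 := ⟨r - 1, by omega⟩
    simp only [Nat.add_sub_cancel]
    set θ : ℝ := k / 2 ^ (q + 1 + 1) with hθ
    have hev : ∀ m : ℕ, k * ((2 * m : ℕ) : ℝ) / 2 ^ (q + 1) = k * m / 2 ^ q := by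
      intro m
      push_cast
      field_simp
      try ring
    have hod : ∀ m : ℕ, k * ((2 * m + 1 : ℕ) : ℝ) / 2 ^ (q + 1) = k * m / 2 ^ q + 2 * θ := by
      intro m
      rw [hθ]
      push_cast
      field_simp
      try ring
    have hc : ∑ m ∈ Finset.range (2 ^ (q + 1 + 1)), Real.cos (k * m / 2 ^ (q + 1))
        = (∑ m ∈ Finset.range (2 ^ (q + 1)), Real.cos (k * m / 2 ^ q)) * Real.cos (2 * θ)
          - (∑ m ∈ Finset.range (2 ^ (q + 1)), Real.sin (k * m / 2 ^ q)) * Real.sin (2 * θ)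
          + ∑ m ∈ Finset.range (2 ^ (q + 1)), Real.cos (k * m / 2 ^ q) := by
      rw [pow_succ' 2 (q + 1), sum_range_two_mul_aux]
      simp only [hev, hod, Real.cos_add, Finset.sum_sub_distrib, Finset.sum_mul]
    have hs : ∑ m ∈ Finset.range (2 ^ (q + 1 + 1)), Real.sin (k * m / 2 ^ (q + 1))
        = (∑ m ∈ Finset.range (2 ^ (q + 1)), Real.sin (k * m / 2 ^ q)) * Real.cos (2 * θ)
          + (∑ m ∈ Finset.range (2 ^ (q + 1)), Real.cos (k * m / 2 ^ q)) * Real.sin (2 * θ)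
          + ∑ m ∈ Finset.range (2 ^ (q + 1)), Real.sin (k * m / 2 ^ q) := by
      rw [pow_succ' 2 (q + 1), sum_range_two_mul_aux]
      simp only [hev, hod, Real.sin_add, Finset.sum_add_distrib, Finset.sum_mul]
    rw [hc, hs, Real.cos_two_mul', Real.sin_two_mul, pow_succ (2 : ℝ) (q + 1)]
    generalize (2 : ℝ) ^ (q + 1) = p
    generalize ∑ m ∈ Finset.range (2 ^ (q + 1)), Real.cos (k * m / 2 ^ q) = c
    generalize ∑ m ∈ Finset.range (2 ^ (q + 1)), Real.sin (k * m / 2 ^ q) = s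
    have h1 := Real.sin_sq_add_cos_sq θ
    ext i j
    fin_cases i <;> fin_cases j <;>
      simp [rotMat, Matrix.mul_apply, Fin.sum_univ_two]
    · linear_combination (p / 2) * h1
    · ring
    · ring
    · linear_combination (p / 2) * h1
end

section
/- (Closed form of the right environment tensor.) Fix a ∈ ℝ and let R(θ) = !![cos θ, sin θ; −sin θ, cos θ] ∈ Matrix (Fin 2) (Fin 2) ℝ. Suppose T : ℕ → Matrix (Fin 2) (Fin 2) ℝ satisfies T 1 = (1/2) • !![1 − cos(2a), sin(2a); sin(2a), 3 + cos(2a)] and, for all r ≥ 1, T (r+1) = R(2^r·a) · T r · (R(2^r·a))ᵀ + T r. Then for all r ≥ 1, T r = (1/2) • !![2^r − S_c(r), S_s(r); S_s(r), 2^r + S_c(r)], where S_c(r) = ∑_{m=0}^{2^r − 1} cos(2·a·m) and S_s(r) = ∑_{m=0}^{2^r − 1} sin(2·a·m). -/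
open Real Matrix

/-- **Closed form of the right environment tensor.**  If `T 1` is the stated base case and
`T (r+1) = R(2^r·a) · T r · R(2^r·a)ᵀ + T r` for all `r ≥ 1`, then for all `r ≥ 1`,
`T r = (1/2) • !![2^r − S_c(r), S_s(r); S_s(r), 2^r + S_c(r)]` where
`S_c(r) = ∑_{m<2^r} cos(2·a·m)` and `S_s(r) = ∑_{m<2^r} sin(2·a·m)`. -/
theorem right_environment_closed_form (a : ℝ) (T : ℕ → Matrix (Fin 2) (Fin 2) ℝ)
    (hbase : T 1 = (1 / 2 : ℝ) •
      !![1 - Real.cos (2 * a), Real.sin (2 * a); Real.sin (2 * a), 3 + Real.cos (2 * a)])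
    (hrec : ∀ r, 1 ≤ r →
      T (r + 1) = rotMat (2 ^ r * a) * T r * (rotMat (2 ^ r * a))ᵀ + T r) :
    ∀ r, 1 ≤ r → T r = (1 / 2 : ℝ) •
      !![(2 : ℝ) ^ r - ∑ m ∈ Finset.range (2 ^ r), Real.cos (2 * a * m),
          ∑ m ∈ Finset.range (2 ^ r), Real.sin (2 * a * m);
          ∑ m ∈ Finset.range (2 ^ r), Real.sin (2 * a * m),
          (2 : ℝ) ^ r + ∑ m ∈ Finset.range (2 ^ r), Real.cos (2 * a * m)] := by
  intro r hr
  induction r, hr using Nat.le_induction with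
  | base =>
    rw [hbase]
    ext i j
    fin_cases i <;> fin_cases j <;> simp [Finset.sum_range_succ] <;> ring
  | succ r hr ih =>
    have hc : ∑ m ∈ Finset.range (2 ^ (r + 1)), Real.cos (2 * a * m)
        = ∑ m ∈ Finset.range (2 ^ r), Real.cos (2 * a * m)
          + ((∑ m ∈ Finset.range (2 ^ r), Real.cos (2 * a * m)) * Real.cos (2 * (2 ^ r * a))
            - (∑ m ∈ Finset.range (2 ^ r), Real.sin (2 * a * m)) * Real.sin (2 * (2 ^ r * a))) := by
      rw [pow_succ, mul_two, Finset.sum_range_add, Finset.sum_mul, Finset.sum_mul,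
        ← Finset.sum_sub_distrib]
      congr 1
      refine Finset.sum_congr rfl fun m _ => ?_
      rw [← Real.cos_add]
      congr 1
      push_cast
      ring
    have hs : ∑ m ∈ Finset.range (2 ^ (r + 1)), Real.sin (2 * a * m)
        = ∑ m ∈ Finset.range (2 ^ r), Real.sin (2 * a * m)
          + ((∑ m ∈ Finset.range (2 ^ r), Real.sin (2 * a * m)) * Real.cos (2 * (2 ^ r * a))
            + (∑ m ∈ Finset.range (2 ^ r), Real.cos (2 * a * m)) * Real.sin (2 * (2 ^ r * a))) := by
      rw [pow_succ, mul_two, Finset.sum_range_add, Finset.sum_mul, Finset.sum_mul]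
      congr 1
      rw [← Finset.sum_add_distrib]
      refine Finset.sum_congr rfl fun m _ => ?_
      rw [← Real.sin_add]
      congr 1
      push_cast
      ring
    rw [hrec r hr, ih, hc, hs, Real.cos_two_mul, Real.sin_two_mul, rotMat]
    generalize (∑ m ∈ Finset.range (2 ^ r), Real.cos (2 * a * m)) = C
    generalize (∑ m ∈ Finset.range (2 ^ r), Real.sin (2 * a * m)) = S
    have h1 := Real.sin_sq_add_cos_sq (2 ^ r * a)
    generalize Real.cos (2 ^ r * a) = c at *
    generalize Real.sin (2 ^ r * a) = s at *
    rw [pow_succ]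
    generalize (2 : ℝ) ^ r = N at *
    ext i j
    fin_cases i <;> fin_cases j <;> simp [Matrix.vecMul, dotProduct, Fin.sum_univ_two]
    · linear_combination (1 / 2) * (N + C) * h1
    · linear_combination (-1 / 2) * S * h1
    · linear_combination (-1 / 2) * S * h1
    · linear_combination (1 / 2) * (N - C) * h1
end

section
/- Fix reals k > 0 and φ, and for q ∈ ℕ set δ_q = 2^{−q−1}·k, Δ = 4k − 2·sin(2(k+φ)) + 2·sin(2φ), a_q = (2k − (sin((2+2^{−q−1})k + 2φ) − sin(2^{−q−1}k + 2φ))/cos(δ_q))/Δ, b_q = (2k·cos(δ_q) − (sin(2(k+φ)) − sin(2φ))/cos(δ_q))/Δ, and d_q = (2k − (sin((2−2^{−q−1})k + 2φ) − sin(2φ − 2^{−q−1}k))/cos(δ_q))/Δ. Then a_q → 1/2, b_q → 1/2, and d_q → 1/2 as q → ∞; that is, the reduced density operator ρ_q^∞ = !![a_q, b_q; b_q, d_q] converges to the projector |+⟩⟨+| = (1/2)·!![1, 1; 1, 1]. -/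
open Real

/-- The common denominator `Δ = 4k − 2 sin(2(k+φ)) + 2 sin(2φ)`. -/
noncomputable def Δden (k φ : ℝ) : ℝ :=
  4 * k - 2 * Real.sin (2 * (k + φ)) + 2 * Real.sin (2 * φ)

/-- `δ_q = 2^{−q−1}·k`. -/
noncomputable def δq (k : ℝ) (q : ℕ) : ℝ := (2 : ℝ) ^ (-(q : ℤ) - 1) * k

/-- The `(0,0)` entry `a_q` of the reduced density operator `ρ_q^∞`. -/
noncomputable def aq (k φ : ℝ) (q : ℕ) : ℝ :=
  (2 * k - (Real.sin ((2 + (2 : ℝ) ^ (-(q : ℤ) - 1)) * k + 2 * φ) -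
      Real.sin ((2 : ℝ) ^ (-(q : ℤ) - 1) * k + 2 * φ)) / Real.cos (δq k q)) / Δden k φ

/-- The off-diagonal entry `b_q` of the reduced density operator `ρ_q^∞`. -/
noncomputable def bq (k φ : ℝ) (q : ℕ) : ℝ :=
  (2 * k * Real.cos (δq k q) -
      (Real.sin (2 * (k + φ)) - Real.sin (2 * φ)) / Real.cos (δq k q)) / Δden k φ

/-- The `(1,1)` entry `d_q` of the reduced density operator `ρ_q^∞`. -/
noncomputable def dq (k φ : ℝ) (q : ℕ) : ℝ :=
  (2 * k - (Real.sin ((2 - (2 : ℝ) ^ (-(q : ℤ) - 1)) * k + 2 * φ) -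
      Real.sin (2 * φ - (2 : ℝ) ^ (-(q : ℤ) - 1) * k)) / Real.cos (δq k q)) / Δden k φ

theorem Δden_pos_aux (k φ : ℝ) (hk : 0 < k) : 0 < Δden k φ := by
  have h : Δden k φ = 4 * (k - Real.sin k * Real.cos (k + 2 * φ)) := by
    unfold Δden
    have h1 : 2 * (k + φ) = (k + 2 * φ) + k := by ring
    have h2 : 2 * φ = (k + 2 * φ) - k := by ring
    have h3 : Real.sin (2 * φ) = Real.sin ((k + 2 * φ) - k) := by rw [← h2]
    rw [h1, h3, Real.sin_add, Real.sin_sub]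
    ring
  rw [h]
  have h1 : |Real.sin k| < k := by
    have h5 := Real.abs_sin_lt_abs hk.ne'
    rwa [abs_of_pos hk] at h5
  have h2 : Real.sin k * Real.cos (k + 2 * φ) ≤ |Real.sin k| := by
    refine (le_abs_self _).trans ?_
    rw [abs_mul]
    exact mul_le_of_le_one_right (abs_nonneg _) (Real.abs_cos_le_one _)
  linarith

theorem two_zpow_tendsto_aux :
    Filter.Tendsto (fun q : ℕ => (2 : ℝ) ^ (-(q : ℤ) - 1)) Filter.atTop (nhds 0) := by
  have h := (tendsto_pow_atTop_nhds_zero_of_lt_one (r := (1 / 2 : ℝ)) (by norm_num)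
    (by norm_num)).mul_const (1 / 2 : ℝ)
  rw [zero_mul] at h
  refine h.congr fun q => ?_
  rw [zpow_sub₀ (by norm_num), zpow_neg, zpow_natCast]
  simp [div_eq_mul_inv]

/-- Convergence of the reduced density operator towards `|+⟩⟨+|`:
`a_q → 1/2`, `b_q → 1/2`, and `d_q → 1/2` as `q → ∞`. -/
theorem rho_tendsto_plus_state (k φ : ℝ) (hk : 0 < k) :
    Filter.Tendsto (fun q => aq k φ q) Filter.atTop (nhds (1 / 2)) ∧
      Filter.Tendsto (fun q => bq k φ q) Filter.atTop (nhds (1 / 2)) ∧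
        Filter.Tendsto (fun q => dq k φ q) Filter.atTop (nhds (1 / 2)) := by
  have hΔ := (Δden_pos_aux k φ hk).ne'
  have hd : Δden k φ = 2 * (2 * k - (Real.sin (2 * k + 2 * φ) - Real.sin (2 * φ))) := by
    unfold Δden
    rw [mul_add]
    ring
  have hne : 2 * k - (Real.sin (2 * k + 2 * φ) - Real.sin (2 * φ)) ≠ 0 := by
    intro h0
    rw [h0, mul_zero] at hd
    exact hΔ hd
  have hhalf : (2 * k - (Real.sin (2 * k + 2 * φ) - Real.sin (2 * φ))) / Δden k φ = 1 / 2 := by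
    rw [hd, div_eq_div_iff (mul_ne_zero two_ne_zero hne) two_ne_zero]
    ring
  have key : ∀ F : ℝ → ℝ, ContinuousAt F 0 → F 0 = 1 / 2 →
      Filter.Tendsto (fun q : ℕ => F ((2 : ℝ) ^ (-(q : ℤ) - 1))) Filter.atTop (nhds (1 / 2)) := by
    intro F hF h0
    rw [← h0]
    exact hF.tendsto.comp two_zpow_tendsto_aux
  have hc : Real.cos (0 * k) ≠ 0 := by simp
  refine ⟨?_, ?_, ?_⟩
  · refine key (fun t => (2 * k - (Real.sin ((2 + t) * k + 2 * φ) -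
      Real.sin (t * k + 2 * φ)) / Real.cos (t * k)) / Δden k φ) ?_ ?_
    · fun_prop (disch := assumption)
    · simpa using hhalf
  · refine key (fun t => (2 * k * Real.cos (t * k) -
      (Real.sin (2 * (k + φ)) - Real.sin (2 * φ)) / Real.cos (t * k)) / Δden k φ) ?_ ?_
    · fun_prop (disch := assumption)
    · simpa [mul_add] using hhalf
  · refine key (fun t => (2 * k - (Real.sin ((2 - t) * k + 2 * φ) -
      Real.sin (2 * φ - t * k)) / Real.cos (t * k)) / Δden k φ) ?_ ?_
    · fun_prop (disch := assumption)
    · simpa using hhalf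
end

section
/- For every real k > 0, the ratio (∑_{i=0}^{2^n − 1} sin(k·i/2^n)·sin(k·(i+1)/2^n)) / (∑_{i=0}^{2^n − 1} sin(k·i/2^n)²) tends to 1 as n → ∞. -/
theorem sine_sq_sum_tendsto_atTop (k : ℝ) (hk : 0 < k) :
    Filter.Tendsto (fun n : ℕ =>
      ∑ i ∈ Finset.range (2 ^ n), Real.sin (k * i / 2 ^ n) ^ 2)
      Filter.atTop Filter.atTop := by
  obtain ⟨M, hM⟩ := pow_unbounded_of_one_lt k (one_lt_two : (1:ℝ) < 2)
  have hP : (0:ℝ) < 2 ^ M := by positivity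
  have hkM : k / 2 ^ M ≤ 1 := by rw [div_le_one hP]; exact hM.le
  have hlow : 0 < k / 2 ^ (M + 1) := by positivity
  have hlow1 : k / 2 ^ (M + 1) ≤ 1 := by
    refine le_trans ?_ hkM
    rw [pow_succ]
    gcongr
    linarith
  set c := Real.sin (k / 2 ^ (M + 1)) with hc
  have hcpos : 0 < c := Real.sin_pos_of_pos_of_lt_pi hlow (by linarith [Real.pi_gt_three])
  rw [← Filter.tendsto_add_atTop_iff_nat (M + 1)]
  have hbase : Filter.Tendsto (fun m : ℕ => (2:ℝ) ^ m * c ^ 2) Filter.atTop Filter.atTop :=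
    (tendsto_pow_atTop_atTop_of_one_lt one_lt_two).atTop_mul_const (by positivity)
  refine Filter.tendsto_atTop_mono (fun m => ?_) hbase
  have hsub : Finset.Ico (2 ^ m) (2 ^ (m + 1)) ⊆ Finset.range (2 ^ (m + (M + 1))) := by
    intro i hi
    rw [Finset.mem_Ico] at hi
    rw [Finset.mem_range]
    exact hi.2.trans_le (Nat.pow_le_pow_right (by norm_num) (by omega))
  refine le_trans ?_ (Finset.sum_le_sum_of_subset_of_nonneg hsub (fun _ _ _ => sq_nonneg _))
  have hcard : (2:ℝ) ^ m * c ^ 2 = ∑ i ∈ Finset.Ico (2 ^ m) (2 ^ (m + 1)), c ^ 2 := by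
    have : 2 ^ (m + 1) - 2 ^ m = 2 ^ m := by rw [pow_succ]; omega
    rw [Finset.sum_const, Nat.card_Ico, this, nsmul_eq_mul]
    push_cast
    rfl
  rw [hcard]
  refine Finset.sum_le_sum (fun i hi => ?_)
  rw [Finset.mem_Ico] at hi
  have h1 : (2:ℝ) ^ m ≤ i := by exact_mod_cast hi.1
  have h2 : (i:ℝ) ≤ 2 ^ (m + 1) := by exact_mod_cast hi.2.le
  have hl : k / 2 ^ (M + 1) ≤ k * i / 2 ^ (m + (M + 1)) := by
    rw [div_le_div_iff₀ (by positivity) (by positivity), pow_add 2 m]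
    calc k * (2 ^ m * 2 ^ (M + 1)) = k * 2 ^ m * 2 ^ (M + 1) := by ring
      _ ≤ k * i * 2 ^ (M + 1) := by gcongr
  have hu : k * i / 2 ^ (m + (M + 1)) ≤ 1 := by
    rw [div_le_one (by positivity)]
    calc k * i ≤ 2 ^ M * 2 ^ (m + 1) := by gcongr
      _ = 2 ^ (m + (M + 1)) := by ring
  have hs : c ≤ Real.sin (k * i / 2 ^ (m + (M + 1))) :=
    Real.sin_le_sin_of_le_of_le_pi_div_two (by linarith [Real.pi_gt_three])
      (by linarith [Real.pi_gt_three]) hl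
  gcongr

/-- The nearest-neighbour correlation ratio of the amplitude-encoded sine function tends
to `1`: for every `k > 0`,
`(∑_{i<2^n} sin(k·i/2^n)·sin(k·(i+1)/2^n)) / (∑_{i<2^n} sin(k·i/2^n)²) → 1` as `n → ∞`. -/
theorem sine_correlation_ratio_tendsto_one (k : ℝ) (hk : 0 < k) :
    Filter.Tendsto (fun n : ℕ =>
        (∑ i ∈ Finset.range (2 ^ n),
            Real.sin (k * i / 2 ^ n) * Real.sin (k * (i + 1) / 2 ^ n)) /
          (∑ i ∈ Finset.range (2 ^ n), Real.sin (k * i / 2 ^ n) ^ 2))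
      Filter.atTop (nhds 1) := by
  have hD := sine_sq_sum_tendsto_atTop k hk
  set D : ℕ → ℝ := fun n => ∑ i ∈ Finset.range (2 ^ n), Real.sin (k * i / 2 ^ n) ^ 2 with hDdef
  let C : ℕ → ℝ := fun n =>
    ∑ i ∈ Finset.range (2 ^ n), Real.sin (k * i / 2 ^ n) * Real.cos (k * i / 2 ^ n)
  have hh : Filter.Tendsto (fun n : ℕ => k / (2:ℝ) ^ n) Filter.atTop (nhds 0) :=
    (tendsto_pow_atTop_atTop_of_one_lt one_lt_two).const_div_atTop k
  have hcos : Filter.Tendsto (fun n : ℕ => Real.cos (k / (2:ℝ) ^ n)) Filter.atTop (nhds 1) := by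
    have := (Real.continuous_cos.tendsto 0).comp hh
    rwa [Real.cos_zero] at this
  have hCb : ∀ n, |Real.sin (k / 2 ^ n) * C n| ≤ k := by
    intro n
    have h1 : |Real.sin (k / 2 ^ n)| ≤ k / 2 ^ n := by
      refine (Real.abs_sin_le_abs (x := k / 2 ^ n)).trans ?_
      rw [abs_of_pos (by positivity)]
    have h2 : |C n| ≤ 2 ^ n := by
      refine (Finset.abs_sum_le_sum_abs _ _).trans ?_
      calc _ ≤ ∑ i ∈ Finset.range (2 ^ n), (1:ℝ) := by
            refine Finset.sum_le_sum (fun i _ => ?_)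
            rw [abs_mul]
            exact mul_le_one₀ (Real.abs_sin_le_one _) (abs_nonneg _) (Real.abs_cos_le_one _)
        _ = 2 ^ n := by simp
    rw [abs_mul]
    calc _ ≤ k / 2 ^ n * 2 ^ n := by gcongr
      _ = k := by field_simp
  have hrest : Filter.Tendsto (fun n => Real.sin (k / 2 ^ n) * C n / D n)
      Filter.atTop (nhds 0) := by
    refine squeeze_zero_norm' ?_ (hD.const_div_atTop k)
    filter_upwards [hD.eventually_gt_atTop 0] with n hn
    rw [Real.norm_eq_abs, abs_div, abs_of_pos hn]
    exact div_le_div_of_nonneg_right (hCb n) hn.le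
  have hsum := hcos.add hrest
  rw [add_zero] at hsum
  refine hsum.congr' ?_
  filter_upwards [hD.eventually_gt_atTop 0] with n hn
  have hnum : (∑ i ∈ Finset.range (2 ^ n),
      Real.sin (k * i / 2 ^ n) * Real.sin (k * (i + 1) / 2 ^ n)) =
      Real.cos (k / 2 ^ n) * D n + Real.sin (k / 2 ^ n) * C n := by
    simp only [hDdef, C]
    rw [Finset.mul_sum, Finset.mul_sum, ← Finset.sum_add_distrib]
    refine Finset.sum_congr rfl (fun i _ => ?_)
    have : k * ((i:ℝ) + 1) / 2 ^ n = k * i / 2 ^ n + k / 2 ^ n := by ring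
    rw [this, Real.sin_add]
    ring
  have hne : D n ≠ 0 := hn.ne'
  change _ = _ / D n
  rw [hnum, add_div, mul_div_cancel_right₀ _ hne]
end
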